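/- Confluence of logical reductions: if a TLL term m logically reduces in zero or more steps to m₁ and also in zero or more steps to m₂, then there exists a term n such that m₁ logically reduces in zero or more steps to n and m₂ logically reduces in zero or more steps to n. -/

import Mathlib

namespace TLL

/-- The two sorts of TLL: `U` (non-linear) and `L` (linear). -/
inductive Srt : Type
  | U | L
deriving DecidableEq

/-- TLL terms in de Bruijn representation: variables, sorts, the two Π-type
formers (irrelevant `pi0` and relevant `pi1`), the two λ-formers, application,
the erased constant `box`, and heap pointers `ptr`. -/
inductive Tm : Type
  | var  : Nat → Tm
  | srt  : Srt → Tm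
  | pi0  : Srt → Tm → Tm → Tm
  | pi1  : Srt → Tm → Tm → Tm
  | lam0 : Srt → Tm → Tm → Tm
  | lam1 : Srt → Tm → Tm → Tm
  | app  : Tm → Tm → Tm
  | box  : Tm
  | ptr  : Nat → Tm

def upr (ξ : Nat → Nat) : Nat → Nat
  | 0 => 0
  | n + 1 => ξ n + 1

def rename (ξ : Nat → Nat) : Tm → Tm
  | .var x => .var (ξ x)
  | .srt s => .srt s
  | .pi0 t A B => .pi0 t (rename ξ A) (rename (upr ξ) B)
  | .pi1 t A B => .pi1 t (rename ξ A) (rename (upr ξ) B)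
  | .lam0 t A m => .lam0 t (rename ξ A) (rename (upr ξ) m)
  | .lam1 t A m => .lam1 t (rename ξ A) (rename (upr ξ) m)
  | .app m n => .app (rename ξ m) (rename ξ n)
  | .box => .box
  | .ptr l => .ptr l

def up (σ : Nat → Tm) : Nat → Tm
  | 0 => .var 0
  | n + 1 => rename Nat.succ (σ n)

def subst (σ : Nat → Tm) : Tm → Tm
  | .var x => σ x
  | .srt s => .srt s
  | .pi0 t A B => .pi0 t (subst σ A) (subst (up σ) B)
  | .pi1 t A B => .pi1 t (subst σ A) (subst (up σ) B)
  | .lam0 t A m => .lam0 t (subst σ A) (subst (up σ) m)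
  | .lam1 t A m => .lam1 t (subst σ A) (subst (up σ) m)
  | .app m n => .app (subst σ m) (subst σ n)
  | .box => .box
  | .ptr l => .ptr l

/-- `subst1 n m` is `m[n/x]` for the topmost bound variable `x`. -/
def subst1 (n : Tm) (m : Tm) : Tm :=
  subst (fun i => match i with | 0 => n | i + 1 => .var i) m

/-- Logical one-step reduction `m ~> n`: full β-reduction with both β-rules,
closed under all structural subterm positions. -/
inductive LStep : Tm → Tm → Prop
  | beta0 {t A m n} : LStep (.app (.lam0 t A m) n) (subst1 n m)
  | beta1 {t A m n} : LStep (.app (.lam1 t A m) n) (subst1 n m)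
  | appL {m m' n} : LStep m m' → LStep (.app m n) (.app m' n)
  | appR {m n n'} : LStep n n' → LStep (.app m n) (.app m n')
  | pi0A {t A A' B} : LStep A A' → LStep (.pi0 t A B) (.pi0 t A' B)
  | pi0B {t A B B'} : LStep B B' → LStep (.pi0 t A B) (.pi0 t A B')
  | pi1A {t A A' B} : LStep A A' → LStep (.pi1 t A B) (.pi1 t A' B)
  | pi1B {t A B B'} : LStep B B' → LStep (.pi1 t A B) (.pi1 t A B')
  | lam0A {t A A' m} : LStep A A' → LStep (.lam0 t A m) (.lam0 t A' m)
  | lam0M {t A m m'} : LStep m m' → LStep (.lam0 t A m) (.lam0 t A m')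
  | lam1A {t A A' m} : LStep A A' → LStep (.lam1 t A m) (.lam1 t A' m)
  | lam1M {t A m m'} : LStep m m' → LStep (.lam1 t A m) (.lam1 t A m')

/-- Multi-step logical reduction. -/
abbrev LRed : Tm → Tm → Prop := Relation.ReflTransGen LStep

/-- Definitional equality `A ≃ B`: equivalence closure of logical reduction. -/
def Conv (A B : Tm) : Prop := Relation.EqvGen LStep A B

/-- Parallel logical reduction `m ⇒ n`. -/
inductive PStep : Tm → Tm → Prop
  | var {x} : PStep (.var x) (.var x)
  | srt {s} : PStep (.srt s) (.srt s)
  | box : PStep .box .box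
  | ptr {l} : PStep (.ptr l) (.ptr l)
  | pi0 {t A A' B B'} : PStep A A' → PStep B B' → PStep (.pi0 t A B) (.pi0 t A' B')
  | pi1 {t A A' B B'} : PStep A A' → PStep B B' → PStep (.pi1 t A B) (.pi1 t A' B')
  | lam0 {t A A' m m'} : PStep A A' → PStep m m' → PStep (.lam0 t A m) (.lam0 t A' m')
  | lam1 {t A A' m m'} : PStep A A' → PStep m m' → PStep (.lam1 t A m) (.lam1 t A' m')
  | app {m m' n n'} : PStep m m' → PStep n n' → PStep (.app m n) (.app m' n')
  | beta0 {t A m m' n n'} : PStep m m' → PStep n n' →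
      PStep (.app (.lam0 t A m) n) (subst1 n' m')
  | beta1 {t A m m' n n'} : PStep m m' → PStep n n' →
      PStep (.app (.lam1 t A m) n) (subst1 n' m')

/-- Logical contexts: lists of types (de Bruijn). -/
abbrev Ctx := List Tm

/-- `Has Γ x A`: variable `x` has type `A` in logical context `Γ`
(with the appropriate de Bruijn shifts). -/
inductive Has : Ctx → Nat → Tm → Prop
  | zero {Γ A} : Has (A :: Γ) 0 (rename Nat.succ A)
  | succ {Γ x A B} : Has Γ x A → Has (B :: Γ) (x + 1) (rename Nat.succ A)

mutual
/-- Well-formed logical contexts. -/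
inductive LWf : Ctx → Prop
  | nil : LWf []
  | cons {Γ A s} : LWf Γ → LTyped Γ A (.srt s) → LWf (A :: Γ)

/-- The logical typing judgment `Γ ⊢ m : A`. -/
inductive LTyped : Ctx → Tm → Tm → Prop
  | srt {Γ} (s : Srt) : LWf Γ → LTyped Γ (.srt s) (.srt .U)
  | var {Γ x A} : LWf Γ → Has Γ x A → LTyped Γ (.var x) A
  | pi0 {Γ A B s r} (t : Srt) :
      LTyped Γ A (.srt s) → LTyped (A :: Γ) B (.srt r) →
      LTyped Γ (.pi0 t A B) (.srt t)
  | pi1 {Γ A B s r} (t : Srt) :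
      LTyped Γ A (.srt s) → LTyped (A :: Γ) B (.srt r) →
      LTyped Γ (.pi1 t A B) (.srt t)
  | lam0 {Γ A B m} (t : Srt) :
      LTyped (A :: Γ) m B → LTyped Γ (.lam0 t A m) (.pi0 t A B)
  | lam1 {Γ A B m} (t : Srt) :
      LTyped (A :: Γ) m B → LTyped Γ (.lam1 t A m) (.pi1 t A B)
  | app0 {Γ m n A B t} :
      LTyped Γ m (.pi0 t A B) → LTyped Γ n A → LTyped Γ (.app m n) (subst1 n B)
  | app1 {Γ m n A B t} :
      LTyped Γ m (.pi1 t A B) → LTyped Γ n A → LTyped Γ (.app m n) (subst1 n B)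
  | conv {Γ m A B s} :
      LTyped Γ m A → LTyped Γ B (.srt s) → Conv A B → LTyped Γ m B
end

/-- Program context entries: either absent, or a sort-annotated type. -/
abbrev Entry := Option (Srt × Tm)

/-- Program contexts, positionally aligned with the logical context. -/
abbrev PCtx := List Entry

/-- The context constraint `Δ ▷ s`. -/
inductive Restr : PCtx → Srt → Prop
  | nil {s} : Restr [] s
  | skip {Δ s} : Restr Δ s → Restr ((none : Entry) :: Δ) s
  | u {Δ A} : Restr Δ .U → Restr (some (.U, A) :: Δ) .U
  | l {Δ s A} : Restr Δ .L → Restr (some (s, A) :: Δ) .L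

/-- Context merge `Δ₁ ∪̇ Δ₂ = Δ`: contraction on shared `U` entries,
`L` entries occur on exactly one side. -/
inductive Merge : PCtx → PCtx → PCtx → Prop
  | nil : Merge [] [] []
  | contra {Δ₁ Δ₂ Δ A} : Merge Δ₁ Δ₂ Δ →
      Merge (some (.U, A) :: Δ₁) (some (.U, A) :: Δ₂) (some (.U, A) :: Δ)
  | left {Δ₁ Δ₂ Δ A} : Merge Δ₁ Δ₂ Δ →
      Merge (some (.L, A) :: Δ₁) ((none : Entry) :: Δ₂) (some (.L, A) :: Δ)
  | right {Δ₁ Δ₂ Δ A} : Merge Δ₁ Δ₂ Δ →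
      Merge ((none : Entry) :: Δ₁) (some (.L, A) :: Δ₂) (some (.L, A) :: Δ)
  | skip {Δ₁ Δ₂ Δ} : Merge Δ₁ Δ₂ Δ →
      Merge ((none : Entry) :: Δ₁) ((none : Entry) :: Δ₂) ((none : Entry) :: Δ)

/-- `PHas Δ x s A`: the entry `x :s A` occurs in `Δ` and the rest of `Δ`
satisfies `▷ U` (so no linear entry is discarded). -/
inductive PHas : PCtx → Nat → Srt → Tm → Prop
  | zero {Δ s A} : Restr Δ .U → PHas (some (s, A) :: Δ) 0 s (rename Nat.succ A)
  | succN {Δ x s A} : PHas Δ x s A → PHas ((none : Entry) :: Δ) (x + 1) s (rename Nat.succ A)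
  | succU {Δ x s A B} : PHas Δ x s A → PHas (some (.U, B) :: Δ) (x + 1) s (rename Nat.succ A)

/-- Well-formed pairs of logical and program contexts `Γ ; Δ ⊢`. -/
inductive PWf : Ctx → PCtx → Prop
  | nil : PWf [] []
  | cons {Γ Δ A s} : PWf Γ Δ → LTyped Γ A (.srt s) → PWf (A :: Γ) (some (s, A) :: Δ)
  | consN {Γ Δ A s} : PWf Γ Δ → LTyped Γ A (.srt s) → PWf (A :: Γ) ((none : Entry) :: Δ)

/-- The program typing judgment `Γ ; Δ ⊢ m : A`. -/
inductive PTyped : Ctx → PCtx → Tm → Tm → Prop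
  | var {Γ Δ x s A} : PWf Γ Δ → PHas Δ x s A → PTyped Γ Δ (.var x) A
  | lam0 {Γ Δ A B m} (t : Srt) :
      PTyped (A :: Γ) ((none : Entry) :: Δ) m B → Restr Δ t →
      PTyped Γ Δ (.lam0 t A m) (.pi0 t A B)
  | lam1 {Γ Δ A B m s} (t : Srt) :
      PTyped (A :: Γ) (some (s, A) :: Δ) m B → Restr Δ t →
      PTyped Γ Δ (.lam1 t A m) (.pi1 t A B)
  | app0 {Γ Δ m n A B t} :
      PTyped Γ Δ m (.pi0 t A B) → LTyped Γ n A →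
      PTyped Γ Δ (.app m n) (subst1 n B)
  | app1 {Γ Δ₁ Δ₂ Δ m n A B t} :
      PTyped Γ Δ₁ m (.pi1 t A B) → PTyped Γ Δ₂ n A → Merge Δ₁ Δ₂ Δ →
      PTyped Γ Δ (.app m n) (subst1 n B)
  | conv {Γ Δ m A B s} :
      PTyped Γ Δ m A → LTyped Γ B (.srt s) → Conv A B →
      PTyped Γ Δ m B

/-- Program values. -/
inductive Value : Tm → Prop
  | var {x} : Value (.var x)
  | lam0 {t A m} : Value (.lam0 t A m)
  | lam1 {t A m} : Value (.lam1 t A m)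

/-- Program (call-by-value) one-step reduction `m ~~> n`. -/
inductive CStep : Tm → Tm → Prop
  | appL {m m' n} : CStep m m' → CStep (.app m n) (.app m' n)
  | appR {m n n'} : CStep n n' → CStep (.app m n) (.app m n')
  | beta0 {t A m n} : CStep (.app (.lam0 t A m) n) (subst1 n m)
  | beta1 {t A m v} : Value v → CStep (.app (.lam1 t A m) v) (subst1 v m)

/-- The erasure judgment `Γ ; Δ ⊢ m ~ m' : A`. -/
inductive Erase : Ctx → PCtx → Tm → Tm → Tm → Prop
  | var {Γ Δ x s A} : PWf Γ Δ → PHas Δ x s A → Erase Γ Δ (.var x) (.var x) A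
  | lam0 {Γ Δ A B m m'} (t : Srt) :
      Erase (A :: Γ) ((none : Entry) :: Δ) m m' B → Restr Δ t →
      Erase Γ Δ (.lam0 t A m) (.lam0 t .box m') (.pi0 t A B)
  | lam1 {Γ Δ A B m m' s} (t : Srt) :
      Erase (A :: Γ) (some (s, A) :: Δ) m m' B → Restr Δ t →
      Erase Γ Δ (.lam1 t A m) (.lam1 t .box m') (.pi1 t A B)
  | app0 {Γ Δ m m' n A B t} :
      Erase Γ Δ m m' (.pi0 t A B) → LTyped Γ n A →
      Erase Γ Δ (.app m n) (.app m' .box) (subst1 n B)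
  | app1 {Γ Δ₁ Δ₂ Δ m m' n n' A B t} :
      Erase Γ Δ₁ m m' (.pi1 t A B) → Erase Γ Δ₂ n n' A → Merge Δ₁ Δ₂ Δ →
      Erase Γ Δ (.app m n) (.app m' n') (subst1 n B)
  | conv {Γ Δ m m' A B s} :
      Erase Γ Δ m m' A → LTyped Γ B (.srt s) → Conv A B →
      Erase Γ Δ m m' B

/-- Heaps: finite maps from locations to sort-annotated values. -/
abbrev Heap := Nat → Option (Srt × Tm)

/-- Heap lookup `Lookup H₁ l v H₂`: non-linear cells persist, linear cells
are deallocated. -/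
inductive Lookup : Heap → Nat → Tm → Heap → Prop
  | u {H l v} : H l = some (.U, v) → Lookup H l v H
  | l {H l v} : H l = some (.L, v) → Lookup H l v (Function.update H l none)

/-- Heap merge `H₁ ∪̇ H₂ = H`. -/
def HMerge (H₁ H₂ H : Heap) : Prop := ∀ l,
  (H₁ l = none ∧ H₂ l = none ∧ H l = none) ∨
  (∃ v, H₁ l = some (.U, v) ∧ H₂ l = some (.U, v) ∧ H l = some (.U, v)) ∨
  (∃ v, H₁ l = some (.L, v) ∧ H₂ l = none ∧ H l = some (.L, v)) ∨
  (∃ v, H₁ l = none ∧ H₂ l = some (.L, v) ∧ H l = some (.L, v))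

/-- The heap constraint `H ▷ s`. -/
def HRestr (H : Heap) : Srt → Prop
  | .U => ∀ l s v, H l = some (s, v) → s = Srt.U
  | .L => True

/-- Heap reduction `H ; m ~~> H' ; m'`. -/
inductive HStep : Heap → Tm → Heap → Tm → Prop
  | alloc0 {H l t m} : H l = none →
      HStep H (.lam0 t .box m) (Function.update H l (some (t, .lam0 t .box m))) (.ptr l)
  | alloc1 {H l t m} : H l = none →
      HStep H (.lam1 t .box m) (Function.update H l (some (t, .lam1 t .box m))) (.ptr l)
  | appL {H H' m m' n} : HStep H m H' m' → HStep H (.app m n) H' (.app m' n)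
  | appR {H H' m n n'} : HStep H n H' n' → HStep H (.app m n) H' (.app m n')
  | beta0 {H H' l t m n} : Lookup H l (.lam0 t .box m) H' →
      HStep H (.app (.ptr l) n) H' (subst1 .box m)
  | beta1 {H H' l₁ l₂ t m} : Lookup H l₁ (.lam1 t .box m) H' →
      HStep H (.app (.ptr l₁) (.ptr l₂)) H' (subst1 (.ptr l₂) m)

/-- Pointer resolution `H ; m ~ n`. -/
inductive Resolve : Heap → Tm → Tm → Prop
  | var {H x} : HRestr H .U → Resolve H (.var x) (.var x)
  | lam0 {H t m' m} : HRestr H t → Resolve H m' m →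
      Resolve H (.lam0 t .box m') (.lam0 t .box m)
  | lam1 {H t m' m} : HRestr H t → Resolve H m' m →
      Resolve H (.lam1 t .box m') (.lam1 t .box m)
  | app0 {H m' m} : Resolve H m' m → Resolve H (.app m' .box) (.app m .box)
  | app1 {H₁ H₂ H m' m n' n} : HMerge H₁ H₂ H →
      Resolve H₁ m' m → Resolve H₂ n' n → Resolve H (.app m' n') (.app m n)
  | ptr {H H' l v' v} : Lookup H l v' H' → Resolve H' v' v → Resolve H (.ptr l) v

/-- `ClosedUnder k m`: all free de Bruijn variables of `m` are `< k`. -/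
def ClosedUnder : Nat → Tm → Prop
  | k, .var x => x < k
  | _, .srt _ => True
  | k, .pi0 _ A B => ClosedUnder k A ∧ ClosedUnder (k + 1) B
  | k, .pi1 _ A B => ClosedUnder k A ∧ ClosedUnder (k + 1) B
  | k, .lam0 _ A m => ClosedUnder k A ∧ ClosedUnder (k + 1) m
  | k, .lam1 _ A m => ClosedUnder k A ∧ ClosedUnder (k + 1) m
  | k, .app m n => ClosedUnder k m ∧ ClosedUnder k n
  | _, .box => True
  | _, .ptr _ => True

/-- WR-heaps: heaps plausibly produced by heap reduction. -/
inductive WrHeap : Heap → Prop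
  | nil : WrHeap (fun _ => none)
  | lam0 {H l t m} : ClosedUnder 1 m → WrHeap H → H l = none →
      WrHeap (Function.update H l (some (t, .lam0 t .box m)))
  | lam1 {H l t m} : ClosedUnder 1 m → WrHeap H → H l = none →
      WrHeap (Function.update H l (some (t, .lam1 t .box m)))

/-- Well-resolved `H ⊢ a ~ b ~ c : A`. -/
def WellResolved (H : Heap) (a b c A : Tm) : Prop :=
  Erase [] [] a b A ∧ Resolve H c b

section Substitution

theorem subst_congr {σ τ : Nat → Tm} (h : ∀ x, σ x = τ x) (m : Tm) :
    subst σ m = subst τ m := by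
  rw [funext h]

theorem upr_comp (ξ ζ : Nat → Nat) : upr ξ ∘ upr ζ = upr (ξ ∘ ζ) := by
  funext x
  cases x <;> rfl

theorem rename_rename (m : Tm) (ξ ζ : Nat → Nat) :
    rename ξ (rename ζ m) = rename (ξ ∘ ζ) m := by
  induction m generalizing ξ ζ with
  | pi0 t A B ihA ihB | pi1 t A B ihA ihB | lam0 t A B ihA ihB | lam1 t A B ihA ihB =>
    simp only [rename, ihA, ihB, upr_comp]
  | _ => simp_all [rename]

theorem up_comp_upr (σ : Nat → Tm) (ξ : Nat → Nat) :
    up σ ∘ upr ξ = up (σ ∘ ξ) := by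
  funext x
  cases x <;> rfl

theorem subst_rename (m : Tm) (σ : Nat → Tm) (ξ : Nat → Nat) :
    subst σ (rename ξ m) = subst (σ ∘ ξ) m := by
  induction m generalizing σ ξ with
  | pi0 t A B ihA ihB | pi1 t A B ihA ihB | lam0 t A B ihA ihB | lam1 t A B ihA ihB =>
    simp only [rename, subst, ihA, ihB, up_comp_upr]
  | _ => simp_all [rename, subst]

theorem rename_upr_up (ξ : Nat → Nat) (σ : Nat → Tm) :
    rename (upr ξ) ∘ up σ = up (rename ξ ∘ σ) := by
  funext x
  cases x with
  | zero => rfl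
  | succ x =>
    simp only [up, Function.comp_apply, rename_rename]
    rfl

theorem rename_subst (m : Tm) (ξ : Nat → Nat) (σ : Nat → Tm) :
    rename ξ (subst σ m) = subst (rename ξ ∘ σ) m := by
  induction m generalizing ξ σ with
  | pi0 t A B ihA ihB | pi1 t A B ihA ihB | lam0 t A B ihA ihB | lam1 t A B ihA ihB =>
    simp only [rename, subst, ihA, ihB, rename_upr_up]
  | _ => simp_all [rename, subst]

theorem subst_up_up (σ τ : Nat → Tm) :
    subst (up σ) ∘ up τ = up (subst σ ∘ τ) := by
  funext x
  cases x with
  | zero => rfl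
  | succ x =>
    simp only [up, Function.comp_apply, subst_rename, rename_subst]
    rfl

theorem subst_subst (m : Tm) (σ τ : Nat → Tm) :
    subst σ (subst τ m) = subst (subst σ ∘ τ) m := by
  induction m generalizing σ τ with
  | pi0 t A B ihA ihB | pi1 t A B ihA ihB | lam0 t A B ihA ihB | lam1 t A B ihA ihB =>
    simp only [subst, ihA, ihB, subst_up_up]
  | _ => simp_all [subst]

theorem up_var : up Tm.var = Tm.var := by
  funext x
  cases x <;> rfl

theorem subst_var (m : Tm) : subst Tm.var m = m := by
  induction m with
  | pi0 t A B ihA ihB | pi1 t A B ihA ihB | lam0 t A B ihA ihB | lam1 t A B ihA ihB =>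
    simp only [subst]
    rw [up_var, ihA, ihB]
  | _ => simp_all [subst]

/-- The substitution sending variable `0` to `n` and lowering all other variables. -/
def single (n : Tm) : Nat → Tm
  | 0 => n
  | i + 1 => .var i

theorem subst1_eq_subst_single (n m : Tm) : subst1 n m = subst (single n) m :=
  subst_congr (fun x => by cases x <;> rfl) m

theorem rename_subst1 (ξ : Nat → Nat) (n m : Tm) :
    rename ξ (subst1 n m) = subst1 (rename ξ n) (rename (upr ξ) m) := by
  simp only [subst1_eq_subst_single, rename_subst, subst_rename]
  refine subst_congr (fun x => ?_) m
  cases x <;> rfl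

theorem subst_subst1 (σ : Nat → Tm) (n m : Tm) :
    subst σ (subst1 n m) = subst1 (subst σ n) (subst (up σ) m) := by
  simp only [subst1_eq_subst_single, subst_subst]
  refine subst_congr (fun x => ?_) m
  cases x with
  | zero => rfl
  | succ x =>
    simp only [Function.comp_apply, up, subst_rename]
    exact (subst_var (σ x)).symm

end Substitution

section ParallelReduction

theorem PStep.refl (m : Tm) : PStep m m := by
  induction m <;> constructor <;> assumption

theorem PStep.rename {m m' : Tm} (h : PStep m m') (ξ : Nat → Nat) :
    PStep (rename ξ m) (rename ξ m') := by
  induction h generalizing ξ with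
  | beta0 _ _ ihm ihn =>
    rw [rename_subst1]
    exact .beta0 (ihm _) (ihn _)
  | beta1 _ _ ihm ihn =>
    rw [rename_subst1]
    exact .beta1 (ihm _) (ihn _)
  | _ => constructor <;> apply_assumption

theorem PStep.up {σ τ : Nat → Tm} (h : ∀ x, PStep (σ x) (τ x)) (x : Nat) :
    PStep (up σ x) (up τ x) := by
  cases x with
  | zero => exact .var
  | succ x => exact (h x).rename _

theorem PStep.subst {m m' : Tm} (h : PStep m m') {σ τ : Nat → Tm}
    (hσ : ∀ x, PStep (σ x) (τ x)) : PStep (subst σ m) (subst τ m') := by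
  induction h generalizing σ τ with
  | var => exact hσ _
  | srt => exact .srt
  | box => exact .box
  | ptr => exact .ptr
  | pi0 _ _ ihA ihB => exact .pi0 (ihA hσ) (ihB (PStep.up hσ))
  | pi1 _ _ ihA ihB => exact .pi1 (ihA hσ) (ihB (PStep.up hσ))
  | lam0 _ _ ihA ihm => exact .lam0 (ihA hσ) (ihm (PStep.up hσ))
  | lam1 _ _ ihA ihm => exact .lam1 (ihA hσ) (ihm (PStep.up hσ))
  | app _ _ ihm ihn => exact .app (ihm hσ) (ihn hσ)
  | beta0 _ _ ihm ihn =>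
    rw [subst_subst1]
    exact .beta0 (ihm (PStep.up hσ)) (ihn hσ)
  | beta1 _ _ ihm ihn =>
    rw [subst_subst1]
    exact .beta1 (ihm (PStep.up hσ)) (ihn hσ)

theorem PStep.subst1 {m m' n n' : Tm} (hm : PStep m m') (hn : PStep n n') :
    PStep (subst1 n m) (subst1 n' m') := by
  simp only [subst1_eq_subst_single]
  refine hm.subst fun x => ?_
  cases x with
  | zero => exact hn
  | succ x => exact .var

/-- Complete development: contracts every redex of the term simultaneously. -/
def develop : Tm → Tm
  | .var x => .var x
  | .srt s => .srt s
  | .box => .box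
  | .ptr l => .ptr l
  | .pi0 t A B => .pi0 t (develop A) (develop B)
  | .pi1 t A B => .pi1 t (develop A) (develop B)
  | .lam0 t A m => .lam0 t (develop A) (develop m)
  | .lam1 t A m => .lam1 t (develop A) (develop m)
  | .app (.lam0 _ _ m) n => subst1 (develop n) (develop m)
  | .app (.lam1 _ _ m) n => subst1 (develop n) (develop m)
  | .app m n => .app (develop m) (develop n)

/-- Every parallel reduct of a term reduces in parallel to its complete development. -/
theorem PStep.develop {m m' : Tm} (h : PStep m m') : PStep m' (develop m) := by
  induction h with
  | beta0 _ _ ihm ihn | beta1 _ _ ihm ihn => exact ihm.subst1 ihn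
  | @app m _ _ _ hm _ ihm ihn =>
    cases m with
    | lam0 =>
      cases hm
      cases ihm with
      | lam0 _ ihb => exact .beta0 ihb ihn
    | lam1 =>
      cases hm
      cases ihm with
      | lam1 _ ihb => exact .beta1 ihb ihn
    | _ => exact .app ihm ihn
  | _ => constructor <;> assumption

theorem LStep.pstep {m m' : Tm} (h : LStep m m') : PStep m m' := by
  induction h <;> constructor <;> first | assumption | exact PStep.refl _

theorem LRed.congr₂ {f : Tm → Tm → Tm}
    (hl : ∀ {a a' b}, LStep a a' → LStep (f a b) (f a' b))
    (hr : ∀ {a b b'}, LStep b b' → LStep (f a b) (f a b'))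
    {a a' b b' : Tm} (ha : LRed a a') (hb : LRed b b') : LRed (f a b) (f a' b') :=
  (ha.lift (f · b) fun _ _ => hl).trans (hb.lift (f a') fun _ _ => hr)

theorem PStep.lred {m m' : Tm} (h : PStep m m') : LRed m m' := by
  induction h with
  | var | srt | box | ptr => exact .refl
  | pi0 _ _ ihA ihB => exact LRed.congr₂ (f := .pi0 _) .pi0A .pi0B ihA ihB
  | pi1 _ _ ihA ihB => exact LRed.congr₂ (f := .pi1 _) .pi1A .pi1B ihA ihB
  | lam0 _ _ ihA ihm => exact LRed.congr₂ (f := .lam0 _) .lam0A .lam0M ihA ihm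
  | lam1 _ _ ihA ihm => exact LRed.congr₂ (f := .lam1 _) .lam1A .lam1M ihA ihm
  | app _ _ ihm ihn => exact LRed.congr₂ (f := .app) .appL .appR ihm ihn
  | @beta0 t A _ _ _ _ _ _ ihm ihn =>
    exact (LRed.congr₂ (f := fun m n => .app (.lam0 t A m) n)
      (fun h => .appL (.lam0M h)) .appR ihm ihn).tail .beta0
  | @beta1 t A _ _ _ _ _ _ ihm ihn =>
    exact (LRed.congr₂ (f := fun m n => .app (.lam1 t A m) n)
      (fun h => .appL (.lam1M h)) .appR ihm ihn).tail .beta1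

theorem reflTransGen_pstep_eq_reflTransGen_lstep :
    Relation.ReflTransGen PStep = Relation.ReflTransGen LStep :=
  le_antisymm (Relation.reflTransGen_closed fun _ _ => PStep.lred)
    (Relation.ReflTransGen.mono fun _ _ => LStep.pstep)

end ParallelReduction

/-- Confluence of logical reductions. -/
theorem confluence_of_logical_reductions {m m₁ m₂ : Tm}
    (h₁ : Relation.ReflTransGen LStep m m₁)
    (h₂ : Relation.ReflTransGen LStep m m₂) :
    ∃ n : Tm, Relation.ReflTransGen LStep m₁ n ∧ Relation.ReflTransGen LStep m₂ n := by
  rw [← reflTransGen_pstep_eq_reflTransGen_lstep] at h₁ h₂ ⊢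
  exact Relation.church_rosser
    (fun _ _ _ hb hc => ⟨_, .single hb.develop, .single hc.develop⟩) h₁ h₂

end TLL
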